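/- The velocity field obtained from the Biot–Savart kernel satisfies the interpolation bound ‖v‖²_{L^∞} ≤ C ‖ω‖_{L²_p}^{3/2} (‖ω‖_{L²_p} + ‖∇ω‖_{L²_p})^{1/2}, where ‖ω‖²_{L²_p} = ∫_{ℝ²} |ω(ξ)|² e^{|ξ|²/4} dξ; in particular ‖v‖_{L^∞} ≤ C(‖ω‖_{L²_p} + ‖ω‖_{L²_p}^{1/2} ‖∇ω‖_{L²_p}^{1/2}). -/

import Mathlib

open MeasureTheory Real

noncomputable abbrev E2 : Type := EuclideanSpace ℝ (Fin 2)

/-- The Biot–Savart kernel `K(x) = (1/2π) x^⊥ / |x|²` on `ℝ²`. -/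
noncomputable def biotSavartK (x : E2) : E2 :=
  (2 * Real.pi * ‖x‖ ^ 2)⁻¹ • (EuclideanSpace.single 0 (x 1) - EuclideanSpace.single 1 (x 0))

/-- Gaussian weight `p(ξ) = e^{|ξ|²/4}`. -/
noncomputable def gaussWeight (ξ : E2) : ℝ := Real.exp (‖ξ‖ ^ 2 / 4)

/-- Weighted norm `‖ω‖_{L²_p} = (∫ |ω|² e^{|ξ|²/4})^{1/2}`. -/
noncomputable def L2pNorm (ω : E2 → ℝ) : ℝ :=
  Real.sqrt (∫ ξ, ω ξ ^ 2 * gaussWeight ξ)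

/-- Weighted norm of the gradient, `‖∇ω‖_{L²_p}`. -/
noncomputable def L2pNormGrad (ω : E2 → ℝ) : ℝ :=
  Real.sqrt (∫ ξ, ‖fderiv ℝ ω ξ‖ ^ 2 * gaussWeight ξ)

open Set Filter Topology ENNReal

/-- Integration by parts against `r` on the half-line. -/
lemma lintegral_Ioi_sq_le_of_hasDerivAt {f f' g : ℝ → ℝ} (hf : ∀ r, HasDerivAt f (f' r) r)
    (hfg : ∀ r, |f' r| ≤ g r)
    (h₁ : IntegrableOn (fun r => r * f r ^ 2) (Ioi 0))
    (h₂ : IntegrableOn (fun r => r * (|f r| * g r)) (Ioi 0)) :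
    ∫⁻ r in Ioi (0 : ℝ), ENNReal.ofReal (f r ^ 2) ≤
      2 * ∫⁻ r in Ioi (0 : ℝ), ENNReal.ofReal (r * (|f r| * g r)) := by
  have hfc : Continuous f := continuous_iff_continuousAt.2 fun r => (hf r).continuousAt
  have hf'm : Measurable f' := by
    rw [show f' = deriv f from funext fun r => (hf r).deriv.symm]
    exact measurable_deriv f
  have h₃ : IntegrableOn (fun r => r * (f r * f' r)) (Ioi 0) := by
    refine h₂.mono' (by fun_prop) ?_
    refine (ae_restrict_iff' measurableSet_Ioi).2 (.of_forall fun r (hr : 0 < r) => ?_)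
    rw [norm_mul, norm_mul, Real.norm_of_nonneg hr.le]
    simp only [Real.norm_eq_abs]
    gcongr
    exact hfg r
  have hsq : IntegrableOn (fun r => f r ^ 2) (Ioi 0) := by
    rw [← Ioc_union_Ioi_eq_Ioi (zero_le_one' ℝ)]
    refine IntegrableOn.union ?_ ?_
    · exact ((hfc.pow 2).integrableOn_Icc).mono_set Ioc_subset_Icc_self
    · refine (h₁.mono_set (Ioi_subset_Ioi zero_le_one)).mono' (by fun_prop) ?_
      refine (ae_restrict_iff' measurableSet_Ioi).2 (.of_forall fun r (hr : 1 < r) => ?_)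
      rw [Real.norm_of_nonneg (sq_nonneg _)]
      nlinarith [sq_nonneg (f r)]
  have hd : ∀ r, HasDerivAt (fun r => r * f r ^ 2) (f r ^ 2 + 2 * (r * (f r * f' r))) r := by
    intro r
    refine HasDerivAt.congr_deriv ((hasDerivAt_id r).mul ((hf r).pow 2)) ?_
    simp only [id_eq, Nat.cast_ofNat]
    ring
  have hd_int : IntegrableOn (fun r => f r ^ 2 + 2 * (r * (f r * f' r))) (Ioi 0) :=
    hsq.add (h₃.const_mul 2)
  have hlim := tendsto_zero_of_hasDerivAt_of_integrableOn_Ioi (fun r _ => hd r) hd_int h₁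
  have hzero := integral_Ioi_of_hasDerivAt_of_tendsto (hd 0).continuousAt.continuousWithinAt
    (fun r _ => hd r) hd_int hlim
  rw [integral_add hsq (h₃.const_mul 2), integral_const_mul] at hzero
  have hle : ∫ r in Ioi (0 : ℝ), f r ^ 2 ≤ 2 * ∫ r in Ioi (0 : ℝ), r * (|f r| * g r) := by
    have : -∫ r in Ioi (0 : ℝ), r * (f r * f' r) ≤ ∫ r in Ioi (0 : ℝ), r * (|f r| * g r) := by
      rw [← integral_neg]
      refine setIntegral_mono_on h₃.neg h₂ measurableSet_Ioi fun r (hr : 0 < r) => ?_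
      have : -(f r * f' r) ≤ |f r| * g r :=
        (neg_le_abs _).trans ((abs_mul _ _).le.trans (by gcongr; exact hfg r))
      nlinarith
    simp only [zero_mul, sub_zero] at hzero
    linarith
  rw [← ofReal_integral_eq_lintegral_ofReal hsq (.of_forall fun r => sq_nonneg _),
    ← ofReal_integral_eq_lintegral_ofReal h₂, ← ENNReal.ofReal_ofNat,
    ← ENNReal.ofReal_mul (by norm_num)]
  · exact ENNReal.ofReal_le_ofReal hle
  · refine (ae_restrict_iff' measurableSet_Ioi).2 (.of_forall fun r (hr : 0 < r) => ?_)
    have := (abs_nonneg _).trans (hfg r)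
    simp only [Pi.zero_apply]
    positivity

/-- The unit vector of the plane at angle `θ`. -/
noncomputable def unitVec (θ : ℝ) : E2 := !₂[Real.cos θ, Real.sin θ]

lemma norm_unitVec (θ : ℝ) : ‖unitVec θ‖ = 1 := by
  simp [unitVec, EuclideanSpace.norm_eq]

lemma measurable_unitVec : Measurable unitVec := by
  unfold unitVec
  fun_prop

/-- Polar coordinates on the Euclidean plane. -/
lemma lintegral_E2_polar {F : E2 → ℝ≥0∞} (hF : Measurable F) :
    ∫⁻ z, F z = ∫⁻ θ in Ioo (-π) π, ∫⁻ r in Ioi (0 : ℝ),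
      ENNReal.ofReal r * F (r • unitVec θ) := by
  have h₁ := ((PiLp.volume_preserving_toLp (Fin 2)).comp
    (volume_preserving_finTwoArrow ℝ).symm).lintegral_comp hF
  rw [← h₁, ← lintegral_comp_polarCoord_symm, polarCoord_target, Measure.volume_eq_prod,
    ← Measure.prod_restrict, lintegral_prod_symm]
  · refine lintegral_congr fun θ => lintegral_congr fun r => ?_
    simp only [smul_eq_mul]
    congr 2
    ext i
    fin_cases i <;> simp [unitVec]
  · refine Measurable.aemeasurable ?_
    simp only [smul_eq_mul]
    have : Measurable (polarCoord.symm : ℝ × ℝ → ℝ × ℝ) :=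
      continuous_polarCoord_symm.measurable
    have := (PiLp.volume_preserving_toLp (Fin 2)).measurable
    fun_prop

/-- Hardy (Kato) inequality in the plane. -/
lemma lintegral_sq_div_norm_le {ω : E2 → ℝ} (hω : Differentiable ℝ ω)
    (h₁ : Integrable fun y => ω y ^ 2) (h₂ : Integrable fun y => |ω y| * ‖fderiv ℝ ω y‖) (x : E2) :
    ∫⁻ z, ENNReal.ofReal (ω (x - z) ^ 2 * ‖z‖⁻¹) ≤
      2 * ∫⁻ y, ENNReal.ofReal (|ω y| * ‖fderiv ℝ ω y‖) := by
  have hωc := hω.continuous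
  have hDm := measurable_fderiv ℝ ω
  have hm₁ : Measurable fun z => ENNReal.ofReal (ω (x - z) ^ 2) := by fun_prop
  have hm₂ : Measurable fun z => ENNReal.ofReal (|ω (x - z)| * ‖fderiv ℝ ω (x - z)‖) := by fun_prop
  have hm₃ : Measurable fun z => ENNReal.ofReal (ω (x - z) ^ 2 * ‖z‖⁻¹) := by fun_prop
  have hf₁ := (h₁.comp_sub_left x).lintegral_lt_top
  have hf₂ := (h₂.comp_sub_left x).lintegral_lt_top
  rw [← lintegral_sub_left_eq_self (fun y => ENNReal.ofReal (|ω y| * ‖fderiv ℝ ω y‖)) x,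
    lintegral_E2_polar hm₃, lintegral_E2_polar hm₂,
    ← lintegral_const_mul' _ _ (by simp)]
  rw [lintegral_E2_polar hm₁] at hf₁
  rw [lintegral_E2_polar hm₂] at hf₂
  have key : ∀ {F : E2 → ℝ≥0∞}, Measurable F → Measurable fun θ =>
      ∫⁻ r in Ioi (0 : ℝ), ENNReal.ofReal r * F (r • unitVec θ) := by
    intro F hF
    refine Measurable.lintegral_prod_right' (f := fun p : ℝ × ℝ =>
      ENNReal.ofReal p.2 * F (p.2 • unitVec p.1)) ?_
    have := measurable_unitVec
    fun_prop
  refine lintegral_mono_ae ?_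
  filter_upwards [ae_lt_top (key hm₁) hf₁.ne, ae_lt_top (key hm₂) hf₂.ne] with θ i₁ i₂
  have hnorm : ∀ᵐ r ∂(volume.restrict (Ioi (0 : ℝ))), 0 < r :=
    (ae_restrict_iff' measurableSet_Ioi).2 (.of_forall fun r hr => hr)
  have e₁ : ∫⁻ r in Ioi (0 : ℝ), ENNReal.ofReal r * ENNReal.ofReal (ω (x - r • unitVec θ) ^ 2) =
      ∫⁻ r in Ioi (0 : ℝ), ENNReal.ofReal (r * ω (x - r • unitVec θ) ^ 2) := by
    refine lintegral_congr_ae ?_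
    filter_upwards [hnorm] with r hr
    rw [ENNReal.ofReal_mul hr.le]
  have e₂ : ∫⁻ r in Ioi (0 : ℝ), ENNReal.ofReal r * ENNReal.ofReal
        (|ω (x - r • unitVec θ)| * ‖fderiv ℝ ω (x - r • unitVec θ)‖) =
      ∫⁻ r in Ioi (0 : ℝ), ENNReal.ofReal
        (r * (|ω (x - r • unitVec θ)| * ‖fderiv ℝ ω (x - r • unitVec θ)‖)) := by
    refine lintegral_congr_ae ?_
    filter_upwards [hnorm] with r hr
    rw [ENNReal.ofReal_mul hr.le]
  have e₃ : ∫⁻ r in Ioi (0 : ℝ), ENNReal.ofReal r * ENNReal.ofReal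
        (ω (x - r • unitVec θ) ^ 2 * ‖r • unitVec θ‖⁻¹) =
      ∫⁻ r in Ioi (0 : ℝ), ENNReal.ofReal (ω (x - r • unitVec θ) ^ 2) := by
    refine lintegral_congr_ae ?_
    filter_upwards [hnorm] with r hr
    rw [← ENNReal.ofReal_mul hr.le, norm_smul, norm_unitVec, Real.norm_of_nonneg hr.le]
    congr 1
    field_simp
  rw [e₁] at i₁
  rw [e₂] at i₂
  rw [e₃, e₂]
  have hline : ∀ r : ℝ, HasDerivAt (fun r : ℝ => x - r • unitVec θ) (-unitVec θ) r := fun r => by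
    simpa using ((hasDerivAt_id r).smul_const (unitVec θ)).const_sub x
  refine lintegral_Ioi_sq_le_of_hasDerivAt
    (fun r => (hω _).hasFDerivAt.comp_hasDerivAt r (hline r)) (fun r => ?_) ?_ ?_
  · simpa [norm_unitVec] using (fderiv ℝ ω (x - r • unitVec θ)).le_opNorm (-unitVec θ)
  · refine ⟨by fun_prop, (hasFiniteIntegral_iff_ofReal ?_).2 i₁⟩
    filter_upwards [hnorm] with r hr
    simp only [Pi.zero_apply]
    positivity
  · have hDr : Measurable fun r : ℝ => ‖fderiv ℝ ω (x - r • unitVec θ)‖ :=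
      (hDm.comp (by fun_prop)).norm
    have hωr : Measurable fun r : ℝ => |ω (x - r • unitVec θ)| :=
      (hωc.measurable.comp (by fun_prop)).norm
    refine ⟨by fun_prop, (hasFiniteIntegral_iff_ofReal ?_).2 i₂⟩
    filter_upwards [hnorm] with r hr
    simp only [Pi.zero_apply]
    positivity

/-- A uniform bound for the convolution of `‖z‖ ^ (-3/2)` with a Gaussian. -/
lemma exists_lintegral_rpow_mul_exp_le :
    ∃ M : ℝ, 0 < M ∧ ∀ x : E2, ∫⁻ z : E2,
      ENNReal.ofReal (‖z‖ ^ (-(3 / 2) : ℝ) * Real.exp (-‖x - z‖ ^ 2 / 8)) ≤ ENNReal.ofReal M := by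
  have i₁ : IntegrableOn (fun z : E2 => ‖z‖ ^ (-(3 / 2) : ℝ)) (Metric.ball 0 1) := by
    rw [integrableOn_fun_norm_addHaar volume (f := fun r => r ^ (-(3 / 2) : ℝ))]
    have := (intervalIntegral.intervalIntegrable_rpow' (a := 0) (b := 1)
      (r := -(1 / 2)) (by norm_num))
    rw [intervalIntegrable_iff_integrableOn_Ioo_of_le zero_le_one] at this
    refine this.congr_fun (fun r hr => ?_) measurableSet_Ioo
    have hr0 : 0 < r := hr.1
    simp only [finrank_euclideanSpace, Fintype.card_fin, smul_eq_mul]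
    rw [show (-(1 / 2) : ℝ) = 1 + -(3 / 2) by norm_num, Real.rpow_add hr0]
    simp
  have i₂ : Integrable (fun z : E2 => Real.exp (-‖z‖ ^ 2 / 8)) := by
    have := (GaussianFourier.integrable_cexp_neg_mul_sq_norm_add (V := E2)
      (b := (1 / 8 : ℂ)) (by norm_num) 0 0).re
    refine this.congr (.of_forall fun z => ?_)
    have : -(1 / 8 : ℂ) * ‖z‖ ^ 2 + 0 * (inner ℝ 0 z : ℝ) = ((-‖z‖ ^ 2 / 8 : ℝ) : ℂ) := by
      push_cast; ring
    simp only [this]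
    exact Complex.exp_ofReal_re _
  refine ⟨(∫ z in Metric.ball (0 : E2) 1, ‖z‖ ^ (-(3 / 2) : ℝ)) +
    ∫ z : E2, Real.exp (-‖z‖ ^ 2 / 8), ?_, fun x => ?_⟩
  · have : 0 < ∫ z : E2, Real.exp (-‖z‖ ^ 2 / 8) := integral_exp_pos i₂
    have : 0 ≤ ∫ z in Metric.ball (0 : E2) 1, ‖z‖ ^ (-(3 / 2) : ℝ) :=
      integral_nonneg fun z => by positivity
    positivity
  · rw [← integral_indicator measurableSet_ball, 
      ← integral_sub_left_eq_self (fun z : E2 => Real.exp (-‖z‖ ^ 2 / 8)) _ x,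
      ← integral_add (i₁.integrable_indicator measurableSet_ball) (i₂.comp_sub_left x),
      ofReal_integral_eq_lintegral_ofReal (by
        exact (i₁.integrable_indicator measurableSet_ball).add (i₂.comp_sub_left x))]
    · refine lintegral_mono fun z => ENNReal.ofReal_le_ofReal ?_
      have he : Real.exp (-‖x - z‖ ^ 2 / 8) ≤ 1 := by
        rw [Real.exp_le_one_iff]
        have := sq_nonneg ‖x - z‖
        linarith
      have hp := Real.exp_pos (-‖x - z‖ ^ 2 / 8)
      by_cases hz : z ∈ Metric.ball (0 : E2) 1
      · rw [indicator_of_mem hz]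
        have : (0 : ℝ) ≤ ‖z‖ ^ (-(3 / 2) : ℝ) := by positivity
        nlinarith
      · rw [indicator_of_notMem hz]
        have : ‖z‖ ^ (-(3 / 2) : ℝ) ≤ 1 :=
          Real.rpow_le_one_of_one_le_of_nonpos (by simpa using hz) (by norm_num)
        nlinarith
    · refine .of_forall fun z => add_nonneg (indicator_nonneg (fun z _ => ?_) z) (Real.exp_pos _).le
      positivity

/-- Cauchy–Schwarz for the lower Lebesgue integral. -/
lemma lintegral_ofReal_mul_sq_le {α : Type*} [MeasurableSpace α] {μ : Measure α} {f g : α → ℝ}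
    (hf : Measurable f) (hg : Measurable g) (hf0 : ∀ a, 0 ≤ f a) (hg0 : ∀ a, 0 ≤ g a) :
    (∫⁻ a, ENNReal.ofReal (f a * g a) ∂μ) ^ 2 ≤
      (∫⁻ a, ENNReal.ofReal (f a ^ 2) ∂μ) * ∫⁻ a, ENNReal.ofReal (g a ^ 2) ∂μ := by
  have h := ENNReal.lintegral_mul_le_Lp_mul_Lq μ Real.HolderConjugate.two_two
    hf.ennreal_ofReal.aemeasurable hg.ennreal_ofReal.aemeasurable
  have h2 := pow_le_pow_left₀ zero_le h 2
  rw [mul_pow, ← ENNReal.rpow_mul_natCast, ← ENNReal.rpow_mul_natCast] at h2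
  simp only [Pi.mul_apply] at h2
  norm_num at h2
  simpa only [ENNReal.ofReal_mul (hf0 _), ENNReal.ofReal_pow (hf0 _),
    ENNReal.ofReal_pow (hg0 _)] using h2

lemma norm_biotSavartK_le (z : E2) : ‖biotSavartK z‖ ≤ ‖z‖⁻¹ := by
  have hrot : ‖(EuclideanSpace.single 0 (z 1) - EuclideanSpace.single 1 (z 0) : E2)‖ = ‖z‖ := by
    simp [EuclideanSpace.norm_eq, Fin.sum_univ_two, add_comm]
  rw [biotSavartK, norm_smul, hrot, Real.norm_of_nonneg (by positivity)]
  rcases eq_or_ne ‖z‖ 0 with h | h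
  · simp [h]
  · have h2 : 1 ≤ 2 * π := by linarith [Real.two_le_pi]
    have h3 : 0 < ‖z‖ := by positivity
    rw [show (2 * π * ‖z‖ ^ 2)⁻¹ * ‖z‖ = (2 * π)⁻¹ * ‖z‖⁻¹ by field_simp]
    exact mul_le_of_le_one_left (by positivity) (inv_le_one_of_one_le₀ h2)

lemma norm_biotSavart_pow_le {M : ℝ} (hM : 0 < M)
    (hMle : ∀ x : E2, ∫⁻ z : E2,
      ENNReal.ofReal (‖z‖ ^ (-(3 / 2) : ℝ) * Real.exp (-‖x - z‖ ^ 2 / 8)) ≤ ENNReal.ofReal M)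
    {ω : E2 → ℝ} (hω : Differentiable ℝ ω)
    (h₁ : Integrable (fun ξ => ω ξ ^ 2 * gaussWeight ξ))
    (h₂ : Integrable (fun ξ => ‖fderiv ℝ ω ξ‖ ^ 2 * gaussWeight ξ)) (x : E2) :
    ‖∫ y, ω y • biotSavartK (x - y)‖ ^ 8 ≤ 4 * M ^ 4 * L2pNorm ω ^ 6 * L2pNormGrad ω ^ 2 := by
  have hωc := hω.continuous
  have hDm := measurable_fderiv ℝ ω
  have hw : ∀ ξ, 1 ≤ gaussWeight ξ := fun ξ => Real.one_le_exp (by positivity)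
  have hA : ∫⁻ ξ, ENNReal.ofReal (ω ξ ^ 2 * gaussWeight ξ) = ENNReal.ofReal (L2pNorm ω ^ 2) := by
    have h0 : ∀ ξ, 0 ≤ ω ξ ^ 2 * gaussWeight ξ := fun ξ =>
      mul_nonneg (sq_nonneg _) (zero_le_one.trans (hw ξ))
    rw [L2pNorm, Real.sq_sqrt (integral_nonneg h0),
      ofReal_integral_eq_lintegral_ofReal h₁ (.of_forall h0)]
  have hB : ∫⁻ ξ, ENNReal.ofReal (‖fderiv ℝ ω ξ‖ ^ 2 * gaussWeight ξ) =
      ENNReal.ofReal (L2pNormGrad ω ^ 2) := by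
    have h0 : ∀ ξ, 0 ≤ ‖fderiv ℝ ω ξ‖ ^ 2 * gaussWeight ξ := fun ξ =>
      mul_nonneg (sq_nonneg _) (zero_le_one.trans (hw ξ))
    rw [L2pNormGrad, Real.sq_sqrt (integral_nonneg h0),
      ofReal_integral_eq_lintegral_ofReal h₂ (.of_forall h0)]
  have hω2 : Integrable fun y => ω y ^ 2 := by
    refine h₁.mono' (by fun_prop) (.of_forall fun y => ?_)
    rw [Real.norm_of_nonneg (sq_nonneg _)]
    exact le_mul_of_one_le_right (sq_nonneg _) (hw y)
  have hD2 : Integrable fun y => ‖fderiv ℝ ω y‖ ^ 2 := by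
    refine h₂.mono' (by fun_prop) (.of_forall fun y => ?_)
    rw [Real.norm_of_nonneg (sq_nonneg _)]
    exact le_mul_of_one_le_right (sq_nonneg _) (hw y)
  have hωD : Integrable fun y => |ω y| * ‖fderiv ℝ ω y‖ := by
    refine (hω2.add hD2).mono' (by fun_prop) (.of_forall fun y => ?_)
    rw [Real.norm_of_nonneg (by positivity), Pi.add_apply, ← sq_abs (ω y)]
    nlinarith [sq_nonneg (|ω y| - ‖fderiv ℝ ω y‖), sq_nonneg (|ω y|),
      sq_nonneg ‖fderiv ℝ ω y‖]
  set L := ∫⁻ y, ENNReal.ofReal (|ω y| * ‖fderiv ℝ ω y‖)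
  have hLle : L ^ 2 ≤ ENNReal.ofReal (L2pNorm ω ^ 2) * ENNReal.ofReal (L2pNormGrad ω ^ 2) := by
    refine (lintegral_ofReal_mul_sq_le (by fun_prop) (by fun_prop) (fun _ => abs_nonneg _)
      (fun _ => norm_nonneg _)).trans ?_
    rw [← hA, ← hB]
    simp only [sq_abs]
    gcongr with y y
    · exact le_mul_of_one_le_right (sq_nonneg _) (hw y)
    · exact le_mul_of_one_le_right (sq_nonneg _) (hw y)
  have hV : ‖∫ y, ω y • biotSavartK (x - y)‖ₑ ≤ ∫⁻ z, ENNReal.ofReal (|ω (x - z)| * ‖z‖⁻¹) := by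
    refine (enorm_integral_le_lintegral_enorm _).trans ?_
    rw [← lintegral_sub_left_eq_self _ x]
    refine lintegral_mono fun z => ?_
    rw [← ofReal_norm, _root_.sub_sub_cancel, norm_smul, Real.norm_eq_abs]
    gcongr
    exact norm_biotSavartK_le z
  set J := ∫⁻ z, ENNReal.ofReal
    ((|ω (x - z)| * Real.exp (‖x - z‖ ^ 2 / 16) * ‖z‖ ^ (-(1 / 4) : ℝ)) ^ 2)
  have hVJ : (∫⁻ z, ENNReal.ofReal (|ω (x - z)| * ‖z‖⁻¹)) ^ 2 ≤ J * ENNReal.ofReal M := by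
    have hcs := lintegral_ofReal_mul_sq_le (μ := (volume : Measure E2))
      (f := fun z => |ω (x - z)| * Real.exp (‖x - z‖ ^ 2 / 16) * ‖z‖ ^ (-(1 / 4) : ℝ))
      (g := fun z => ‖z‖ ^ (-(3 / 4) : ℝ) * Real.exp (-‖x - z‖ ^ 2 / 16))
      (by fun_prop) (by fun_prop) (fun z => by positivity) (fun z => by positivity)
    refine (Eq.le ?_).trans (hcs.trans (mul_le_mul_right ((Eq.le ?_).trans (hMle x)) _))
    · congr 1
      refine lintegral_congr fun z => congrArg _ ?_
      have e₁ : ‖z‖⁻¹ = ‖z‖ ^ (-(1 / 4) : ℝ) * ‖z‖ ^ (-(3 / 4) : ℝ) := by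
        rw [← Real.rpow_add' (norm_nonneg _) (by norm_num), ← Real.rpow_neg_one]
        norm_num
      have e₂ : Real.exp (‖x - z‖ ^ 2 / 16) * Real.exp (-‖x - z‖ ^ 2 / 16) = 1 := by
        rw [← Real.exp_add, neg_div, add_neg_cancel, Real.exp_zero]
      rw [e₁]
      linear_combination (-|ω (x - z)| * ‖z‖ ^ (-(1 / 4) : ℝ) * ‖z‖ ^ (-(3 / 4) : ℝ)) * e₂
    · refine lintegral_congr fun z => congrArg _ ?_
      rw [mul_pow, ← Real.rpow_mul_natCast (norm_nonneg _), ← Real.exp_nat_mul]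
      congr 2 <;> push_cast <;> ring_nf
  have hJle : J ^ 2 ≤ ENNReal.ofReal (L2pNorm ω ^ 2) * (2 * L) := by
    have hcs := lintegral_ofReal_mul_sq_le (μ := (volume : Measure E2))
      (f := fun z => |ω (x - z)| * Real.exp (‖x - z‖ ^ 2 / 8))
      (g := fun z => |ω (x - z)| * ‖z‖ ^ (-(1 / 2) : ℝ))
      (by fun_prop) (by fun_prop) (fun z => by positivity) (fun z => by positivity)
    refine (Eq.le ?_).trans (hcs.trans (mul_le_mul' (Eq.le ?_)
      ((Eq.le ?_).trans (lintegral_sq_div_norm_le hω hω2 hωD x))))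
    · congr 1
      refine lintegral_congr fun z => congrArg _ ?_
      rw [mul_pow, mul_pow, ← Real.rpow_mul_natCast (norm_nonneg _), ← Real.exp_nat_mul,
        show ((2 : ℕ) : ℝ) * (‖x - z‖ ^ 2 / 16) = ‖x - z‖ ^ 2 / 8 by push_cast; ring,
        show (-(1 / 4) : ℝ) * (2 : ℕ) = -(1 / 2) by norm_num]
      ring
    · rw [← hA, ← lintegral_sub_left_eq_self _ x]
      refine lintegral_congr fun z => congrArg _ ?_
      rw [_root_.sub_sub_cancel, mul_pow, sq_abs, gaussWeight, ← Real.exp_nat_mul,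
        show ((2 : ℕ) : ℝ) * (‖z‖ ^ 2 / 8) = ‖z‖ ^ 2 / 4 by push_cast; ring]
    · refine lintegral_congr fun z => congrArg _ ?_
      rw [mul_pow, sq_abs, ← Real.rpow_mul_natCast (norm_nonneg _), ← Real.rpow_neg_one]
      norm_num
  have hfin : ‖∫ y, ω y • biotSavartK (x - y)‖ₑ ^ 8 ≤
      ENNReal.ofReal (4 * M ^ 4 * L2pNorm ω ^ 6 * L2pNormGrad ω ^ 2) := by
    calc ‖∫ y, ω y • biotSavartK (x - y)‖ₑ ^ 8
        ≤ ((∫⁻ z, ENNReal.ofReal (|ω (x - z)| * ‖z‖⁻¹)) ^ 2) ^ 4 := by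
          rw [← pow_mul]; gcongr
      _ ≤ (J * ENNReal.ofReal M) ^ 4 := by gcongr
      _ = (J ^ 2) ^ 2 * ENNReal.ofReal M ^ 4 := by ring
      _ ≤ (ENNReal.ofReal (L2pNorm ω ^ 2) * (2 * L)) ^ 2 * ENNReal.ofReal M ^ 4 := by gcongr
      _ = 4 * ENNReal.ofReal M ^ 4 * ENNReal.ofReal (L2pNorm ω ^ 2) ^ 2 * L ^ 2 := by ring
      _ ≤ 4 * ENNReal.ofReal M ^ 4 * ENNReal.ofReal (L2pNorm ω ^ 2) ^ 2 *
          (ENNReal.ofReal (L2pNorm ω ^ 2) * ENNReal.ofReal (L2pNormGrad ω ^ 2)) := by gcongr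
      _ = ENNReal.ofReal (4 * M ^ 4 * L2pNorm ω ^ 6 * L2pNormGrad ω ^ 2) := by
          have hA0 : 0 ≤ L2pNorm ω := Real.sqrt_nonneg _
          rw [ENNReal.ofReal_mul (by positivity), ENNReal.ofReal_mul (by positivity),
            ENNReal.ofReal_mul (by positivity), ENNReal.ofReal_pow hM.le, ENNReal.ofReal_pow hA0,
            ENNReal.ofReal_pow hA0, ENNReal.ofReal_ofNat]
          ring
  rw [← ofReal_norm, ← ENNReal.ofReal_pow (norm_nonneg _)] at hfin
  exact (ENNReal.ofReal_le_ofReal_iff (by positivity)).1 hfin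

theorem stmt_7 :
    ∃ C : ℝ, 0 < C ∧
      ∀ (ω : E2 → ℝ) (v : E2 → E2),
        Differentiable ℝ ω →
        Integrable (fun ξ => ω ξ ^ 2 * gaussWeight ξ) (volume : Measure E2) →
        Integrable (fun ξ => ‖fderiv ℝ ω ξ‖ ^ 2 * gaussWeight ξ) (volume : Measure E2) →
        (∀ x, v x = ∫ y, ω y • biotSavartK (x - y)) →
        ∀ x,
          ‖v x‖ ^ 2 ≤
              C * L2pNorm ω ^ ((3 : ℝ) / 2) *
                (L2pNorm ω + L2pNormGrad ω) ^ ((1 : ℝ) / 2) ∧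
          ‖v x‖ ≤
              C * (L2pNorm ω +
                L2pNorm ω ^ ((1 : ℝ) / 2) * L2pNormGrad ω ^ ((1 : ℝ) / 2)) := by
  obtain ⟨M, hM, hMle⟩ := exists_lintegral_rpow_mul_exp_le
  refine ⟨2 * M + 1, by positivity, fun ω v hω h₁ h₂ hv x => ?_⟩
  have h := norm_biotSavart_pow_le hM hMle hω h₁ h₂ x
  rw [← hv x] at h
  have hA : 0 ≤ L2pNorm ω := Real.sqrt_nonneg _
  have hB : 0 ≤ L2pNormGrad ω := Real.sqrt_nonneg _
  set A := L2pNorm ω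
  set B := L2pNormGrad ω
  have hs : (A ^ ((1 : ℝ) / 2)) ^ 2 = A := by
    rw [← Real.rpow_mul_natCast hA]; norm_num
  have ht : (B ^ ((1 : ℝ) / 2)) ^ 2 = B := by
    rw [← Real.rpow_mul_natCast hB]; norm_num
  have hA3 : A ^ ((3 : ℝ) / 2) = (A ^ ((1 : ℝ) / 2)) ^ 3 := by
    rw [← Real.rpow_mul_natCast hA]; norm_num
  have hBle : B ^ ((1 : ℝ) / 2) ≤ (A + B) ^ ((1 : ℝ) / 2) := by
    gcongr
    linarith
  have hs0 : 0 ≤ A ^ ((1 : ℝ) / 2) := by positivity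
  have ht0 : 0 ≤ B ^ ((1 : ℝ) / 2) := by positivity
  rw [hA3]
  set s := A ^ ((1 : ℝ) / 2)
  set t := B ^ ((1 : ℝ) / 2)
  have hsq : ‖v x‖ ^ 2 ≤ (2 * M + 1) * s ^ 3 * t := by
    refine (pow_le_pow_iff_left₀ (by positivity) (by positivity) (n := 4) (by norm_num)).1 ?_
    calc (‖v x‖ ^ 2) ^ 4 = ‖v x‖ ^ 8 := by ring
      _ ≤ 4 * M ^ 4 * A ^ 6 * B ^ 2 := h
      _ = 4 * (M * s ^ 3 * t) ^ 4 := by rw [← hs, ← ht]; ring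
      _ ≤ 16 * (M * s ^ 3 * t) ^ 4 := by gcongr; norm_num
      _ = (2 * M * s ^ 3 * t) ^ 4 := by ring
      _ ≤ ((2 * M + 1) * s ^ 3 * t) ^ 4 := by gcongr; linarith
  refine ⟨hsq.trans (by gcongr), ?_⟩
  refine (pow_le_pow_iff_left₀ (by positivity) (by positivity) (n := 2) (by norm_num)).1 ?_
  calc ‖v x‖ ^ 2 ≤ (2 * M + 1) * s ^ 3 * t := hsq
    _ ≤ (2 * M + 1) ^ 2 * (s ^ 3 * t) := by
      rw [mul_assoc]
      gcongr
      nlinarith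
    _ ≤ (2 * M + 1) ^ 2 * (A + s * t) ^ 2 := by
      gcongr
      rw [← hs]
      have : 0 ≤ s ^ 3 * t := by positivity
      nlinarith [sq_nonneg (s ^ 2), sq_nonneg (s * t)]
    _ = ((2 * M + 1) * (A + s * t)) ^ 2 := by ring
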